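/- arXiv:2010.03605 — 6 statements merged into one kernel-verified Lean document; each statement's English description precedes it below -/
import Mathlib

section
/- Let C > 0 and 0 < α < 1 be given. If max{2M, N}(1+C) · sup_{t∈ℝ} ∫_{−∞}^{∞} |𝒢(t,s)| ε(s)^α Δ₁(s,t)^α ds ≤ C, then the map h from the conjugacy H(t,x,y) = (x + h(t,x,y), y) satisfies |h(t,x₁,y) − h(t,x₂,y)| ≤ C |x₁ − x₂|^α for all t ∈ ℝ, x₁, x₂ ∈ X and y ∈ Y. -/
open MeasureTheory

/-- The Green function `𝒢(t,s)`. -/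
noncomputable def Green {X : Type*} [NormedAddCommGroup X] [NormedSpace ℝ X]
    (T : ℝ → ℝ → X →L[ℝ] X) (P : ℝ → X →L[ℝ] X) (t s : ℝ) : X →L[ℝ] X :=
  if s ≤ t then (T t s).comp (P s)
  else -((T t s).comp (ContinuousLinearMap.id ℝ X - P s))

/-- `T` is the evolution family of `ẋ = A(t)x`. -/
def IsEvolutionFamily {X : Type*} [NormedAddCommGroup X] [NormedSpace ℝ X]
    (A : ℝ → X →L[ℝ] X) (T : ℝ → ℝ → X →L[ℝ] X) : Prop :=
  (∀ s ξ t, HasDerivAt (fun r => T r s ξ) (A t (T t s ξ)) t) ∧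
  (∀ s, T s s = ContinuousLinearMap.id ℝ X) ∧
  (∀ t r s, (T t r).comp (T r s) = T t s)

/-- Pointwise estimate behind the Hölder bound: a quantity dominated by both `2M` and
`e (D + C D ^ α + R)` is dominated by a multiple of `(e D) ^ α` up to `e R`. -/
theorem le_max_mul_rpow_add {M N C α e D R a : ℝ} (hM : 0 ≤ M) (hN : 1 ≤ N) (hC : 0 < C)
    (hα0 : 0 < α) (hα1 : α < 1) (he : 0 < e) (heN : e ≤ N) (hD : 0 ≤ D) (hR : 0 ≤ R)
    (ha : a ≤ 2 * M) (ha' : a ≤ e * (D + (C * D ^ α + R))) :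
    a ≤ max (2 * M) N * (1 + C) * (e * D) ^ α + e * R := by
  have heD : 0 ≤ e * D := by positivity
  have hr : 0 ≤ (e * D) ^ α := by positivity
  have heR : 0 ≤ e * R := by positivity
  rcases le_total 1 (e * D) with h1 | h1
  · have h2 : 1 ≤ (e * D) ^ α := Real.one_le_rpow h1 hα0.le
    have h3 : 2 * M ≤ max (2 * M) N := le_max_left _ _
    have h4 : 1 ≤ (1 + C) * (e * D) ^ α := by nlinarith
    have h5 : max (2 * M) N * 1 ≤ max (2 * M) N * ((1 + C) * (e * D) ^ α) :=
      mul_le_mul_of_nonneg_left h4 (by linarith)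
    linarith
  · have h2 : e * D ≤ (e * D) ^ α := Real.self_le_rpow_of_le_one heD h1 hα1.le
    have h3 : N ≤ max (2 * M) N := le_max_right _ _
    have h4 : e * D ^ α ≤ N * (e * D) ^ α := by
      have h5 : e = e ^ (1 - α) * e ^ α := by
        rw [← Real.rpow_add he]; simp
      have h6 : e ^ (1 - α) ≤ N :=
        (Real.rpow_le_rpow he.le heN (by linarith)).trans
          (Real.rpow_le_self_of_one_le hN (by linarith))
      rw [Real.mul_rpow he.le hD]
      calc e * D ^ α = e ^ (1 - α) * (e ^ α * D ^ α) := by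
            rw [← mul_assoc, ← h5]
        _ ≤ N * (e ^ α * D ^ α) := by gcongr
    have h7 : N * (1 + C) * (e * D) ^ α ≤ max (2 * M) N * (1 + C) * (e * D) ^ α := by gcongr
    nlinarith [mul_le_mul_of_nonneg_left h4 hC.le, mul_le_mul_of_nonneg_right hN hr]

/-- An evolution family with a continuous bound is strongly continuous in its initial time,
jointly with the vector it is applied to. -/
theorem IsEvolutionFamily.continuous_apply_snd {X : Type*} [NormedAddCommGroup X]
    [NormedSpace ℝ X] {A : ℝ → X →L[ℝ] X} {T : ℝ → ℝ → X →L[ℝ] X} (hT : IsEvolutionFamily A T)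
    {t : ℝ} {b : ℝ → ℝ} (hb : Continuous b) (hTb : ∀ s, ‖T t s‖ ≤ b s) :
    Continuous fun p : ℝ × X => T t p.1 p.2 := by
  obtain ⟨hd, hid, hcomp⟩ := hT
  refine continuous_iff_continuousAt.2 fun ⟨s₀, v₀⟩ => ?_
  have hcont : Continuous fun r => T r s₀ v₀ :=
    continuous_iff_continuousAt.2 fun r => (hd s₀ v₀ r).continuousAt
  refine tendsto_iff_norm_sub_tendsto_zero.2 ?_
  have hbound : Continuous fun p : ℝ × X => b p.1 * ‖p.2 - T p.1 s₀ v₀‖ := by fun_prop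
  refine squeeze_zero (fun _ => norm_nonneg _) (fun p => ?_)
    (show Filter.Tendsto (fun p : ℝ × X => b p.1 * ‖p.2 - T p.1 s₀ v₀‖) (nhds (s₀, v₀))
      (nhds 0) from by simpa [hid] using hbound.tendsto (s₀, v₀))
  have h1 : T t s₀ v₀ = T t p.1 (T p.1 s₀ v₀) := by
    rw [← hcomp t p.1 s₀]; rfl
  show ‖T t p.1 p.2 - T t s₀ v₀‖ ≤ _
  rw [h1, ← map_sub]
  exact (T t p.1).le_of_opNorm_le (hTb p.1) _

/-- The Green function applied to a continuous curve is strongly measurable. -/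
theorem IsEvolutionFamily.stronglyMeasurable_green_apply {X : Type*} [NormedAddCommGroup X]
    [NormedSpace ℝ X] {A : ℝ → X →L[ℝ] X} {T : ℝ → ℝ → X →L[ℝ] X} (hT : IsEvolutionFamily A T)
    {P : ℝ → X →L[ℝ] X} (hP : StronglyMeasurable P) {t : ℝ} {b : ℝ → ℝ} (hb : Continuous b)
    (hTb : ∀ s, ‖T t s‖ ≤ b s) {F : ℝ → X} (hF : Continuous F) :
    StronglyMeasurable fun s => Green T P t s (F s) := by
  have hFm := hF.stronglyMeasurable
  have hPF : StronglyMeasurable fun s => P s (F s) :=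
    (isBoundedBilinearMap_apply (𝕜 := ℝ) (E := X) (F := X)).continuous.comp_stronglyMeasurable
      (hP.prodMk hFm)
  have hTv : ∀ v : ℝ → X, StronglyMeasurable v → StronglyMeasurable fun s => T t s (v s) :=
    fun v hv => (hT.continuous_apply_snd hb hTb).comp_stronglyMeasurable
      (continuous_id.stronglyMeasurable.prodMk hv)
  have heq : (fun s => Green T P t s (F s)) = fun s =>
      if s ∈ Set.Iic t then T t s (P s (F s)) else -(T t s (F s - P s (F s))) := by
    funext s
    by_cases hs : s ≤ t <;> simp [Green, hs]
  rw [heq]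
  exact StronglyMeasurable.ite measurableSet_Iic (hTv _ hPF) (hTv _ (hFm.sub hPF)).neg


theorem holder_continuity_h_in_x
    {X Y : Type*} [NormedAddCommGroup X] [NormedSpace ℝ X] [CompleteSpace X]
    [NormedAddCommGroup Y] [NormedSpace ℝ Y] [CompleteSpace Y]
    (A : ℝ → X →L[ℝ] X) (hA : Continuous A)
    (T : ℝ → ℝ → X →L[ℝ] X) (hT : IsEvolutionFamily A T)
    (f : ℝ → X → Y → X) (hf : Continuous fun p : ℝ × X × Y => f p.1 p.2.1 p.2.2)
    (g : ℝ → Y → Y) (hg : Continuous fun p : ℝ × Y => g p.1 p.2)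
    -- `Φ` is the flow of `ẏ = g(t,y)`; solutions are global and unique
    (Φ : ℝ → ℝ → Y → Y)
    (hΦ : ∀ (τ : ℝ) (η : Y),
      (∀ t, HasDerivAt (fun r => Φ r τ η) (g t (Φ t τ η)) t) ∧ Φ τ τ η = η)
    (hgU : ∀ y w : ℝ → Y, (∀ t, HasDerivAt y (g t (y t)) t) →
      (∀ t, HasDerivAt w (g t (w t)) t) → ∀ τ, y τ = w τ → y = w)
    (P : ℝ → X →L[ℝ] X) (hP : StronglyMeasurable P)
    -- the bound `Δ₁` on the evolution family
    (Δ₁ : ℝ → ℝ → ℝ) (hΔ₁c : Continuous fun p : ℝ × ℝ => Δ₁ p.1 p.2)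
    (hΔ₁pos : ∀ t s, 0 < Δ₁ t s)
    (hTΔ₁ : ∀ t s, ‖T t s‖ ≤ Δ₁ t s)
    -- bounds on `f`
    (M N : ℝ) (hM : 1 ≤ M) (hN : 1 ≤ N)
    (ε : ℝ → ℝ) (hεc : Continuous ε) (hεpos : ∀ t, 0 < ε t) (hεN : ∀ t, ε t ≤ N)
    (hfb : ∀ t x y, ‖f t x y‖ ≤ M)
    (hfl : ∀ t x₁ x₂ y, ‖f t x₁ y - f t x₂ y‖ ≤ ε t * ‖x₁ - x₂‖)
    -- integral conditions
    (K q : ℝ)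
    (hKint : ∀ t, Integrable fun s => ‖Green T P t s‖)
    (hK : ∀ t, (∫ s, ‖Green T P t s‖) ≤ K)
    (hqint : ∀ t, Integrable fun s => ‖Green T P t s‖ * ε s)
    (hq : ∀ t, (∫ s, ‖Green T P t s‖ * ε s) ≤ q)
    (hq1 : q < 1)
    -- `h` is the conjugacy: the bounded continuous fixed point of the operator `T`
    (h : ℝ → X → Y → X)
    (hhc : Continuous fun p : ℝ × X × Y => h p.1 p.2.1 p.2.2)
    (hhb : ∃ B : ℝ, ∀ t x y, ‖h t x y‖ ≤ B)
    (hfix : ∀ (τ : ℝ) (ξ : X) (η : Y), h τ ξ η =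
      ∫ s, Green T P τ s (f s (T s τ ξ + h s (T s τ ξ) (Φ s τ η)) (Φ s τ η)))
    -- the Hölder data
    (C α : ℝ) (hC : 0 < C) (hα0 : 0 < α) (hα1 : α < 1)
    (hint : ∀ t, Integrable fun s => ‖Green T P t s‖ * ε s ^ α * Δ₁ s t ^ α)
    (hcond : ∀ t, max (2 * M) N * (1 + C) *
      (∫ s, ‖Green T P t s‖ * ε s ^ α * Δ₁ s t ^ α) ≤ C) :
    ∀ (t : ℝ) (x₁ x₂ : X) (y : Y), ‖h t x₁ y - h t x₂ y‖ ≤ C * ‖x₁ - x₂‖ ^ α := by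
  obtain ⟨B, hB⟩ := hhb
  have hq0 : 0 ≤ q := (integral_nonneg fun s => mul_nonneg (norm_nonneg _) (hεpos s).le).trans (hq 0)
  have hB0 : 0 ≤ B := (norm_nonneg _).trans (hB 0 0 0)
  have hF : ∀ τ ξ η, Integrable fun s =>
      Green T P τ s (f s (T s τ ξ + h s (T s τ ξ) (Φ s τ η)) (Φ s τ η)) := by
    intro τ ξ η
    have hTc : Continuous fun s => T s τ ξ :=
      continuous_iff_continuousAt.2 fun s => (hT.1 τ ξ s).continuousAt
    have hΦc : Continuous fun s => Φ s τ η :=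
      continuous_iff_continuousAt.2 fun s => ((hΦ τ η).1 s).continuousAt
    have hhs : Continuous fun s => h s (T s τ ξ) (Φ s τ η) :=
      hhc.comp (continuous_id.prodMk (hTc.prodMk hΦc))
    have hfs : Continuous fun s => f s (T s τ ξ + h s (T s τ ξ) (Φ s τ η)) (Φ s τ η) :=
      hf.comp (continuous_id.prodMk ((hTc.add hhs).prodMk hΦc))
    refine ((hKint τ).mul_const M).mono'
      (hT.stronglyMeasurable_green_apply hP (b := fun s => Δ₁ τ s)
        (hΔ₁c.comp (continuous_const.prodMk continuous_id)) (hTΔ₁ τ) hfs).aestronglyMeasurable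
      (Filter.Eventually.of_forall fun s => ?_)
    exact (Green T P τ s).le_opNorm_of_le (hfb _ _ _)
  have step : ∀ R, 0 ≤ R →
      (∀ t x₁ x₂ y, ‖h t x₁ y - h t x₂ y‖ ≤ C * ‖x₁ - x₂‖ ^ α + R) →
      ∀ t x₁ x₂ y, ‖h t x₁ y - h t x₂ y‖ ≤ C * ‖x₁ - x₂‖ ^ α + q * R := by
    intro R hR ih τ x₁ x₂ η
    rw [hfix τ x₁ η, hfix τ x₂ η, ← integral_sub (hF τ x₁ η) (hF τ x₂ η)]
    set c := max (2 * M) N * (1 + C)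
    have hc : 0 ≤ c := mul_nonneg (le_max_of_le_right (by linarith)) (by linarith)
    set d := ‖x₁ - x₂‖
    have hi1 := (hint τ).const_mul (c * d ^ α)
    have hi2 := (hqint τ).mul_const R
    refine (norm_integral_le_of_norm_le (hi1.add hi2)
      (Filter.Eventually.of_forall fun s => ?_)).trans ?_
    · rw [← map_sub]
      set D := ‖T s τ x₁ - T s τ x₂‖ with hDdef
      have hD : D ≤ Δ₁ s τ * d := by
        rw [hDdef, ← map_sub]
        exact (T s τ).le_of_opNorm_le (hTΔ₁ s τ) _
      have key := le_max_mul_rpow_add (C := C) (D := D) (R := R) (by linarith : 0 ≤ M) hN hC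
        hα0 hα1 (hεpos s) (hεN s) (norm_nonneg _) hR
        (a := ‖f s (T s τ x₁ + h s (T s τ x₁) (Φ s τ η)) (Φ s τ η)
          - f s (T s τ x₂ + h s (T s τ x₂) (Φ s τ η)) (Φ s τ η)‖)
        ((norm_sub_le _ _).trans (by
          linarith [hfb s (T s τ x₁ + h s (T s τ x₁) (Φ s τ η)) (Φ s τ η),
            hfb s (T s τ x₂ + h s (T s τ x₂) (Φ s τ η)) (Φ s τ η)]))
        ((hfl _ _ _ _).trans (mul_le_mul_of_nonneg_left (by
          rw [add_sub_add_comm]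
          exact (norm_add_le _ _).trans (add_le_add le_rfl (ih _ _ _ _))) (hεpos s).le))
      have hpow : (ε s * D) ^ α ≤ ε s ^ α * (Δ₁ s τ ^ α * d ^ α) := by
        rw [Real.mul_rpow (hεpos s).le (norm_nonneg _),
          ← Real.mul_rpow (hΔ₁pos s τ).le (norm_nonneg _)]
        exact mul_le_mul_of_nonneg_left (Real.rpow_le_rpow (norm_nonneg _) hD hα0.le)
          (Real.rpow_nonneg (hεpos s).le _)
      calc _ ≤ ‖Green T P τ s‖ * (c * (ε s ^ α * (Δ₁ s τ ^ α * d ^ α)) + ε s * R) :=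
            (Green T P τ s).le_opNorm_of_le
              (key.trans (add_le_add (mul_le_mul_of_nonneg_left hpow hc) le_rfl))
        _ = _ := by simp only [Pi.add_apply]; ring
    · simp only [Pi.add_apply]
      rw [integral_add hi1 hi2, integral_const_mul, integral_mul_const]
      refine add_le_add ?_ (mul_le_mul_of_nonneg_right (hq τ) hR)
      rw [mul_right_comm]
      exact mul_le_mul_of_nonneg_right (hcond τ) (by positivity)
  have iter : ∀ n : ℕ, ∀ t x₁ x₂ y,
      ‖h t x₁ y - h t x₂ y‖ ≤ C * ‖x₁ - x₂‖ ^ α + q ^ n * (2 * B) := by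
    intro n
    induction n with
    | zero =>
      intro t x₁ x₂ y
      have : 0 ≤ C * ‖x₁ - x₂‖ ^ α := by positivity
      linarith [norm_sub_le (h t x₁ y) (h t x₂ y), hB t x₁ y, hB t x₂ y]
    | succ n ih =>
      simpa only [pow_succ', mul_assoc] using step _ (by positivity) ih
  intro t x₁ x₂ y
  have hlim := ((tendsto_pow_atTop_nhds_zero_of_lt_one hq0 hq1).mul_const (2 * B)).const_add
    (C * ‖x₁ - x₂‖ ^ α)
  rw [zero_mul, add_zero] at hlim
  exact ge_of_tendsto' hlim fun n => iter n t x₁ x₂ y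
end

section
/- Let C > 0 and 0 < α < 1 be given. If 2M · sup_{t∈ℝ} ∫_{−∞}^{∞} |𝒢(t,s)| ε(s)^α Δ₂(s,t)^α ds ≤ C, then the map h̄ from the conjugacy H̄(t,x,y) = (x + h̄(t,x,y), y) satisfies |h̄(t,x₁,y) − h̄(t,x₂,y)| ≤ C |x₁ − x₂|^α for all t ∈ ℝ, x₁, x₂ ∈ X and y ∈ Y. -/
open MeasureTheory

/-- `(x, y)` is a solution of the coupled system `ẋ = A(t)x + f(t,x,y)`, `ẏ = g(t,y)`. -/
def IsSolNL {X Y : Type*} [NormedAddCommGroup X] [NormedSpace ℝ X]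
    [NormedAddCommGroup Y] [NormedSpace ℝ Y]
    (A : ℝ → X →L[ℝ] X) (f : ℝ → X → Y → X) (g : ℝ → Y → Y)
    (x : ℝ → X) (y : ℝ → Y) : Prop :=
  (∀ t, HasDerivAt x (A t (x t) + f t (x t) (y t)) t) ∧
  (∀ t, HasDerivAt y (g t (y t)) t)

theorem IsEvolutionFamily.continuous_left
    {X : Type*} [NormedAddCommGroup X] [NormedSpace ℝ X] [CompleteSpace X]
    {A : ℝ → X →L[ℝ] X} (hA : Continuous A) {T : ℝ → ℝ → X →L[ℝ] X}
    (hT : IsEvolutionFamily A T) (t : ℝ) : Continuous fun s => T s t := by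
  rw [continuous_iff_continuousAt]
  intro r
  have hcont : ∀ ξ, Continuous fun s => T s t ξ := fun ξ =>
    continuous_iff_continuousAt.2 fun s => (hT.1 t ξ s).continuousAt
  have hI : IsCompact (Set.Icc (r - 1) (r + 1)) := isCompact_Icc
  obtain ⟨B, hB⟩ : ∃ B, ∀ s : Set.Icc (r - 1) (r + 1), ‖T s t‖ ≤ B := by
    refine banach_steinhaus (g := fun s : Set.Icc (r - 1) (r + 1) => T s t) fun ξ => ?_
    obtain ⟨c, hc⟩ := hI.exists_bound_of_continuousOn (hcont ξ).continuousOn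
    exact ⟨c, fun s => hc s s.2⟩
  obtain ⟨a, ha⟩ := hI.exists_bound_of_continuousOn hA.continuousOn
  have hr : r ∈ Set.Icc (r - 1) (r + 1) := by constructor <;> linarith
  have hB0 : 0 ≤ B := (norm_nonneg _).trans (hB ⟨r, hr⟩)
  have ha0 : 0 ≤ a := (norm_nonneg _).trans (ha r hr)
  have hlip : ∀ s ∈ Set.Icc (r - 1) (r + 1), ‖T s t - T r t‖ ≤ a * B * ‖s - r‖ := by
    intro s hs
    refine ContinuousLinearMap.opNorm_le_bound _ (by positivity) fun ξ => ?_
    have := (convex_Icc (r - 1) (r + 1)).norm_image_sub_le_of_norm_hasDerivWithin_le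
      (f := fun s => T s t ξ) (f' := fun s => A s (T s t ξ)) (C := a * (B * ‖ξ‖))
      (fun u _ => (hT.1 t ξ u).hasDerivWithinAt)
      (fun u hu => (A u).le_of_opNorm_le_of_le (ha u hu)
        ((T u t).le_of_opNorm_le (hB ⟨u, hu⟩) ξ)) hr hs
    calc ‖(T s t - T r t) ξ‖ ≤ a * (B * ‖ξ‖) * ‖s - r‖ := this
      _ = a * B * ‖s - r‖ * ‖ξ‖ := by ring
  rw [ContinuousAt, tendsto_iff_norm_sub_tendsto_zero]
  have h0 : Filter.Tendsto (fun s => a * B * ‖s - r‖) (nhds r) (nhds 0) := by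
    have : Continuous fun s : ℝ => a * B * ‖s - r‖ := by fun_prop
    simpa using this.tendsto r
  refine squeeze_zero' (Filter.Eventually.of_forall fun _ => norm_nonneg _) ?_ h0
  filter_upwards [Icc_mem_nhds (sub_one_lt r) (lt_add_one r)] with s hs using hlip s hs

theorem IsEvolutionFamily.continuous_right
    {X : Type*} [NormedAddCommGroup X] [NormedSpace ℝ X] [CompleteSpace X]
    {A : ℝ → X →L[ℝ] X} (hA : Continuous A) {T : ℝ → ℝ → X →L[ℝ] X}
    (hT : IsEvolutionFamily A T) (t : ℝ) : Continuous fun s => T t s := by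
  let U : ℝ → (X →L[ℝ] X)ˣ := fun s =>
    ⟨T s t, T t s, (hT.2.2 s t s).trans (hT.2.1 s), (hT.2.2 t s t).trans (hT.2.1 t)⟩
  have hinv : (fun s => T t s) = fun s => Ring.inverse (T s t) :=
    funext fun s => (Ring.inverse_unit (U s)).symm
  rw [hinv, continuous_iff_continuousAt]
  exact fun s => (NormedRing.inverse_continuousAt (U s)).comp
    (f := fun s => T s t) (hT.continuous_left hA t).continuousAt

theorem stronglyMeasurable_green
    {X : Type*} [NormedAddCommGroup X] [NormedSpace ℝ X] [CompleteSpace X]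
    {A : ℝ → X →L[ℝ] X} (hA : Continuous A) {T : ℝ → ℝ → X →L[ℝ] X}
    (hT : IsEvolutionFamily A T) {P : ℝ → X →L[ℝ] X} (hP : StronglyMeasurable P) (t : ℝ) :
    StronglyMeasurable fun s => Green T P t s := by
  have hTt : StronglyMeasurable fun s => T t s := (hT.continuous_right hA t).stronglyMeasurable
  exact StronglyMeasurable.ite measurableSet_Iic (hTt.mul hP)
    (hTt.mul (stronglyMeasurable_const.sub hP)).neg

theorem le_mul_rpow_of_le_of_le {d c u α : ℝ} (hc : 1 ≤ c) (hu : 0 ≤ u) (hα0 : 0 < α)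
    (hα1 : α < 1) (hdc : d ≤ c) (hdu : d ≤ u) : d ≤ c * u ^ α := by
  rcases le_total u 1 with h | h
  · calc d ≤ u ^ α := hdu.trans (Real.self_le_rpow_of_le_one hu h hα1.le)
      _ ≤ c * u ^ α := le_mul_of_one_le_left (Real.rpow_nonneg hu α) hc
  · exact hdc.trans (le_mul_of_one_le_right (by linarith) (Real.one_le_rpow h hα0.le))

theorem holder_continuity_hbar_in_x
    {X Y : Type*} [NormedAddCommGroup X] [NormedSpace ℝ X] [CompleteSpace X]
    [NormedAddCommGroup Y] [NormedSpace ℝ Y] [CompleteSpace Y]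
    (A : ℝ → X →L[ℝ] X) (hA : Continuous A)
    (T : ℝ → ℝ → X →L[ℝ] X) (hT : IsEvolutionFamily A T)
    (f : ℝ → X → Y → X) (hf : Continuous fun p : ℝ × X × Y => f p.1 p.2.1 p.2.2)
    (g : ℝ → Y → Y) (hg : Continuous fun p : ℝ × Y => g p.1 p.2)
    -- `Φ` is the flow of `ẏ = g(t,y)`; solutions are global and unique
    (Φ : ℝ → ℝ → Y → Y)
    (hΦ : ∀ (τ : ℝ) (η : Y),
      (∀ t, HasDerivAt (fun r => Φ r τ η) (g t (Φ t τ η)) t) ∧ Φ τ τ η = η)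
    (hgU : ∀ y w : ℝ → Y, (∀ t, HasDerivAt y (g t (y t)) t) →
      (∀ t, HasDerivAt w (g t (w t)) t) → ∀ τ, y τ = w τ → y = w)
    -- `Ψ` is the `x`-component of the flow of the coupled system (2nl)
    (Ψ : ℝ → ℝ → X → Y → X)
    (hΨ : ∀ (τ : ℝ) (ξ : X) (η : Y),
      IsSolNL A f g (fun t => Ψ t τ ξ η) (fun t => Φ t τ η) ∧ Ψ τ τ ξ η = ξ)
    (P : ℝ → X →L[ℝ] X) (hP : StronglyMeasurable P)
    -- the bound `Δ₂` on differences of solutions of (2nl) with the same `y`-component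
    (Δ₂ : ℝ → ℝ → ℝ) (hΔ₂c : Continuous fun p : ℝ × ℝ => Δ₂ p.1 p.2)
    (hΔ₂pos : ∀ t s, 0 < Δ₂ t s)
    (hΔ₂ : ∀ (x z : ℝ → X) (y : ℝ → Y), IsSolNL A f g x y → IsSolNL A f g z y →
      ∀ t s, ‖x t - z t‖ ≤ Δ₂ t s * ‖x s - z s‖)
    -- bounds on `f`
    (M N : ℝ) (hM : 1 ≤ M) (hN : 1 ≤ N)
    (ε : ℝ → ℝ) (hεc : Continuous ε) (hεpos : ∀ t, 0 < ε t) (hεN : ∀ t, ε t ≤ N)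
    (hfb : ∀ t x y, ‖f t x y‖ ≤ M)
    (hfl : ∀ t x₁ x₂ y, ‖f t x₁ y - f t x₂ y‖ ≤ ε t * ‖x₁ - x₂‖)
    -- integral conditions
    (K q : ℝ)
    (hKint : ∀ t, Integrable fun s => ‖Green T P t s‖)
    (hK : ∀ t, (∫ s, ‖Green T P t s‖) ≤ K)
    (hqint : ∀ t, Integrable fun s => ‖Green T P t s‖ * ε s)
    (hq : ∀ t, (∫ s, ‖Green T P t s‖ * ε s) ≤ q)
    (hq1 : q < 1)
    -- `h̄` is the conjugacy from the linearization theorem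
    (hbar : ℝ → X → Y → X)
    (hbarfix : ∀ (τ : ℝ) (ξ : X) (η : Y), hbar τ ξ η =
      -∫ s, Green T P τ s (f s (Ψ s τ ξ η) (Φ s τ η)))
    -- the Hölder data
    (C α : ℝ) (hC : 0 < C) (hα0 : 0 < α) (hα1 : α < 1)
    (hint : ∀ t, Integrable fun s => ‖Green T P t s‖ * ε s ^ α * Δ₂ s t ^ α)
    (hcond : ∀ t, 2 * M * (∫ s, ‖Green T P t s‖ * ε s ^ α * Δ₂ s t ^ α) ≤ C) :
    ∀ (t : ℝ) (x₁ x₂ : X) (y : Y), ‖hbar t x₁ y - hbar t x₂ y‖ ≤ C * ‖x₁ - x₂‖ ^ α := by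
  intro t x₁ x₂ y
  have hcont : ∀ ξ, Continuous fun s => f s (Ψ s t ξ y) (Φ s t y) := fun ξ => by
    have h1 : Continuous fun s => Ψ s t ξ y :=
      continuous_iff_continuousAt.2 fun s => ((hΨ t ξ y).1.1 s).continuousAt
    have h2 : Continuous fun s => Φ s t y :=
      continuous_iff_continuousAt.2 fun s => ((hΨ t ξ y).1.2 s).continuousAt
    exact hf.comp (continuous_id.prodMk (h1.prodMk h2))
  have hGf : ∀ ξ, Integrable fun s => Green T P t s (f s (Ψ s t ξ y) (Φ s t y)) := fun ξ => by
    refine ((hKint t).mul_const M).mono' ?_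
      (.of_forall fun s => (Green T P t s).le_opNorm_of_le (hfb _ _ _))
    exact (isBoundedBilinearMap_apply.continuous.comp_stronglyMeasurable
      ((stronglyMeasurable_green hA hT hP t).prodMk
        (hcont ξ).stronglyMeasurable)).aestronglyMeasurable
  rw [hbarfix, hbarfix, neg_sub_neg, ← integral_sub (hGf x₂) (hGf x₁)]
  have hpt : ∀ s, ‖Green T P t s (f s (Ψ s t x₂ y) (Φ s t y)) -
      Green T P t s (f s (Ψ s t x₁ y) (Φ s t y))‖ ≤
      2 * M * ‖x₁ - x₂‖ ^ α * (‖Green T P t s‖ * ε s ^ α * Δ₂ s t ^ α) := by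
    intro s
    have hΔ := hΔ₂ _ _ _ (hΨ t x₂ y).1 (hΨ t x₁ y).1 s t
    simp only [(hΨ t x₂ y).2, (hΨ t x₁ y).2] at hΔ
    rw [norm_sub_rev x₂] at hΔ
    have hu := (hfl s (Ψ s t x₂ y) (Ψ s t x₁ y) (Φ s t y)).trans
      (mul_le_mul_of_nonneg_left hΔ (hεpos s).le)
    have hd : ‖f s (Ψ s t x₂ y) (Φ s t y) - f s (Ψ s t x₁ y) (Φ s t y)‖ ≤ 2 * M :=
      (norm_sub_le _ _).trans
        ((add_le_add (hfb _ _ _) (hfb _ _ _)).trans_eq (two_mul M).symm)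
    have hε := (hεpos s).le
    have hΔ0 := (hΔ₂pos s t).le
    have hmain := le_mul_rpow_of_le_of_le (by linarith) (by positivity) hα0 hα1 hd hu
    rw [Real.mul_rpow hε (by positivity), Real.mul_rpow hΔ0 (norm_nonneg _)] at hmain
    rw [← map_sub]
    refine ((Green T P t s).le_opNorm_of_le hmain).trans_eq ?_
    ring
  calc _ ≤ ∫ s, 2 * M * ‖x₁ - x₂‖ ^ α * (‖Green T P t s‖ * ε s ^ α * Δ₂ s t ^ α) :=
        norm_integral_le_of_norm_le ((hint t).const_mul _) (.of_forall hpt)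
    _ = 2 * M * (∫ s, ‖Green T P t s‖ * ε s ^ α * Δ₂ s t ^ α) * ‖x₁ - x₂‖ ^ α := by
        rw [integral_const_mul]; ring
    _ ≤ C * ‖x₁ - x₂‖ ^ α :=
        mul_le_mul_of_nonneg_right (hcond t) (by positivity)
end

section
/- Let C > 0 and 0 < α < 1 be given. If max{2M, N}(1+C) · sup_{n∈ℤ} Σ_{m=−∞}^{∞} |𝒢(n,m)| ε_{m−1}^α Δ₁(m−1,n)^α ≤ C, then the maps h_n from the conjugacies H_n(x,y) = (x + h_n(x,y), y) satisfy |h_n(x₁,y) − h_n(x₂,y)| ≤ C |x₁ − x₂|^α for all n ∈ ℤ, x₁, x₂ ∈ X and y ∈ Y. -/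
open MeasureTheory

/-- The discrete Green function `𝒢(m,n)`. -/
noncomputable def GreenD {X : Type*} [NormedAddCommGroup X] [NormedSpace ℝ X]
    (𝒜 : ℤ → ℤ → X →L[ℝ] X) (P : ℤ → X →L[ℝ] X) (m n : ℤ) : X →L[ℝ] X :=
  if n ≤ m then (𝒜 m n).comp (P n)
  else -((𝒜 m n).comp (ContinuousLinearMap.id ℝ X - P n))

/-- `𝒜` is the linear cocycle generated by the sequence of invertible operators `A`. -/
def IsCocycle {X : Type*} [NormedAddCommGroup X] [NormedSpace ℝ X]
    (A : ℤ → X ≃L[ℝ] X) (𝒜 : ℤ → ℤ → X →L[ℝ] X) : Prop :=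
  (∀ n, 𝒜 n n = ContinuousLinearMap.id ℝ X) ∧
  (∀ m n, 𝒜 (m + 1) n = (A m : X →L[ℝ] X).comp (𝒜 m n))

/-- `Φ` is the flow of the difference equation `y_{n+1} = g_n(y_n)`. -/
def IsFlowD {Y : Type*} [TopologicalSpace Y] (g : ℤ → Y ≃ₜ Y) (Φ : ℤ → ℤ → Y → Y) : Prop :=
  (∀ (n : ℤ) (η : Y), Φ n n η = η) ∧
  (∀ (m n : ℤ) (η : Y), Φ (m + 1) n η = g m (Φ m n η))

/-- Interpolation between a uniform bound and a Lipschitz-type bound with a defect `S`. -/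
theorem le_rpow_mul_rpow_add_of_le_of_le {M N C α ε d S t : ℝ} (hM : 1 ≤ M)
    (hC : 0 < C) (hα0 : 0 < α) (hα1 : α < 1) (hε0 : 0 ≤ ε) (hεN : ε ≤ N) (hd : 0 ≤ d)
    (hS : 0 ≤ S) (htM : t ≤ 2 * M) (ht : t ≤ ε * (d + (C * d ^ α + S))) :
    t ≤ max (2 * M) N * (1 + C) * (ε ^ α * d ^ α) + ε * S := by
  have hW1 : 2 * M ≤ max (2 * M) N := le_max_left _ _
  have hW2 : N ≤ max (2 * M) N := le_max_right _ _
  set W := max (2 * M) N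
  have hdα : 0 ≤ d ^ α := Real.rpow_nonneg hd α
  have hεα : 0 ≤ ε ^ α := Real.rpow_nonneg hε0 α
  have hεS : 0 ≤ ε * S := mul_nonneg hε0 hS
  rcases le_total d 1 with hd1 | hd1
  · have h1 : d ≤ d ^ α := Real.self_le_rpow_of_le_one hd hd1 hα1.le
    have h2 : ε ≤ W * ε ^ α := by
      rcases le_total ε 1 with h | h
      · have h3 : ε ≤ ε ^ α := Real.self_le_rpow_of_le_one hε0 h hα1.le
        nlinarith
      · have h3 : 1 ≤ ε ^ α := Real.one_le_rpow h hα0.le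
        nlinarith
    calc t ≤ ε * (d + (C * d ^ α + S)) := ht
      _ ≤ ε * (d ^ α + (C * d ^ α + S)) := by gcongr
      _ = ε * ((1 + C) * d ^ α) + ε * S := by ring
      _ ≤ (W * ε ^ α) * ((1 + C) * d ^ α) + ε * S := by gcongr
      _ = _ := by ring
  · have h1 : d ^ α ≤ d := Real.rpow_le_self_of_one_le hd1 hα1.le
    rw [← Real.mul_rpow hε0 hd]
    have hεd : 0 ≤ ε * d := mul_nonneg hε0 hd
    rcases le_total (ε * d) 1 with h | h
    · have h3 : ε * d ≤ (ε * d) ^ α := Real.self_le_rpow_of_le_one hεd h hα1.le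
      have hW : 1 ≤ W := by linarith
      calc t ≤ ε * (d + (C * d ^ α + S)) := ht
        _ ≤ ε * (d + (C * d + S)) := by gcongr
        _ = 1 * (1 + C) * (ε * d) + ε * S := by ring
        _ ≤ W * (1 + C) * (ε * d) ^ α + ε * S := by gcongr
    · have h3 : 1 ≤ (ε * d) ^ α := Real.one_le_rpow h hα0.le
      calc t ≤ W * 1 * 1 + 0 := by linarith
        _ ≤ W * (1 + C) * (ε * d) ^ α + ε * S := by
          gcongr
          linarith

theorem discrete_holder_in_x_of_h
    {X Y : Type*} [NormedAddCommGroup X] [NormedSpace ℝ X] [CompleteSpace X]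
    [NormedAddCommGroup Y] [NormedSpace ℝ Y] [CompleteSpace Y]
    (A : ℤ → X ≃L[ℝ] X)
    (𝒜 : ℤ → ℤ → X →L[ℝ] X) (h𝒜 : IsCocycle A 𝒜)
    (f : ℤ → X → Y → X) (hf : ∀ n, Continuous fun p : X × Y => f n p.1 p.2)
    (g : ℤ → Y ≃ₜ Y)
    (Φ : ℤ → ℤ → Y → Y) (hΦ : IsFlowD g Φ)
    (P : ℤ → X →L[ℝ] X)
    -- the bound `Δ₁` on the cocycle
    (Δ₁ : ℤ → ℤ → ℝ) (hΔ₁pos : ∀ m n, 0 < Δ₁ m n)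
    (h𝒜Δ₁ : ∀ m n, ‖𝒜 m n‖ ≤ Δ₁ m n)
    -- bounds on `f`
    (M N : ℝ) (hM : 1 ≤ M) (hN : 1 ≤ N)
    (ε : ℤ → ℝ) (hε0 : ∀ n, 0 ≤ ε n) (hεN : ∀ n, ε n ≤ N)
    (hfb : ∀ n x y, ‖f n x y‖ ≤ M)
    (hfl : ∀ (n : ℤ) (x₁ x₂ : X) (y : Y), ‖f n x₁ y - f n x₂ y‖ ≤ ε n * ‖x₁ - x₂‖)
    -- summability conditions
    (K q : ℝ)
    (hKsum : ∀ m, Summable fun n : ℤ => ‖GreenD 𝒜 P m n‖)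
    (hK : ∀ m, (∑' n : ℤ, ‖GreenD 𝒜 P m n‖) ≤ K)
    (hqsum : ∀ m, Summable fun n : ℤ => ‖GreenD 𝒜 P m n‖ * ε (n - 1))
    (hq : ∀ m, (∑' n : ℤ, ‖GreenD 𝒜 P m n‖ * ε (n - 1)) ≤ q)
    (hq1 : q < 1)
    -- `h` is the conjugacy: the bounded continuous fixed point of the operator `T`
    (h : ℤ → X → Y → X)
    (hhc : ∀ n, Continuous fun p : X × Y => h n p.1 p.2)
    (hhb : ∃ B : ℝ, ∀ n x y, ‖h n x y‖ ≤ B)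
    (hfix : ∀ (n : ℤ) (ξ : X) (η : Y), h n ξ η =
      ∑' k : ℤ, GreenD 𝒜 P n k
        (f (k - 1) (𝒜 (k - 1) n ξ + h (k - 1) (𝒜 (k - 1) n ξ) (Φ (k - 1) n η))
          (Φ (k - 1) n η)))
    -- the Hölder data
    (C α : ℝ) (hC : 0 < C) (hα0 : 0 < α) (hα1 : α < 1)
    (hsum : ∀ n, Summable fun m : ℤ =>
      ‖GreenD 𝒜 P n m‖ * ε (m - 1) ^ α * Δ₁ (m - 1) n ^ α)
    (hcond : ∀ n, max (2 * M) N * (1 + C) *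
      (∑' m : ℤ, ‖GreenD 𝒜 P n m‖ * ε (m - 1) ^ α * Δ₁ (m - 1) n ^ α) ≤ C) :
    ∀ (n : ℤ) (x₁ x₂ : X) (y : Y), ‖h n x₁ y - h n x₂ y‖ ≤ C * ‖x₁ - x₂‖ ^ α := by
  obtain ⟨B, hB⟩ := hhb
  have hq0 : 0 ≤ q :=
    (tsum_nonneg fun k => mul_nonneg (norm_nonneg _) (hε0 _)).trans (hq 0)
  have hstep : ∀ S : ℝ, 0 ≤ S →
      (∀ n x₁ x₂ y, ‖h n x₁ y - h n x₂ y‖ ≤ C * ‖x₁ - x₂‖ ^ α + S) →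
      ∀ n x₁ x₂ y, ‖h n x₁ y - h n x₂ y‖ ≤ C * ‖x₁ - x₂‖ ^ α + q * S := by
    intro S hS ih n x₁ x₂ y
    set F : X → ℤ → X := fun ξ k =>
      f (k - 1) (𝒜 (k - 1) n ξ + h (k - 1) (𝒜 (k - 1) n ξ) (Φ (k - 1) n y)) (Φ (k - 1) n y)
      with hF
    have hFsum : ∀ ξ, Summable fun k => GreenD 𝒜 P n k (F ξ k) := fun ξ =>
      Summable.of_norm_bounded ((hKsum n).mul_right M) fun k =>
        (ContinuousLinearMap.le_opNorm _ _).trans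
          (mul_le_mul_of_nonneg_left (hfb _ _ _) (norm_nonneg _))
    have hdiff : h n x₁ y - h n x₂ y = ∑' k, GreenD 𝒜 P n k (F x₁ k - F x₂ k) := by
      rw [hfix n x₁ y, hfix n x₂ y, ← (hFsum x₁).tsum_sub (hFsum x₂)]
      simp only [map_sub, hF]
    set W := max (2 * M) N with hW
    have hW0 : 0 ≤ W := (by linarith : (0 : ℝ) ≤ 2 * M).trans (le_max_left _ _)
    set r := ‖x₁ - x₂‖ ^ α with hr
    have hr0 : 0 ≤ r := Real.rpow_nonneg (norm_nonneg _) _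
    have hFdiff : ∀ k, ‖F x₁ k - F x₂ k‖ ≤
        W * (1 + C) * (ε (k - 1) ^ α * (Δ₁ (k - 1) n ^ α * r)) + ε (k - 1) * S := by
      intro k
      set d := ‖𝒜 (k - 1) n x₁ - 𝒜 (k - 1) n x₂‖ with hd
      have hd0 : 0 ≤ d := norm_nonneg _
      have hdle : d ^ α ≤ Δ₁ (k - 1) n ^ α * r := by
        rw [hr, ← Real.mul_rpow (hΔ₁pos _ _).le (norm_nonneg _)]
        refine Real.rpow_le_rpow hd0 ?_ hα0.le
        rw [hd, ← map_sub]
        exact (𝒜 (k - 1) n).le_of_opNorm_le (h𝒜Δ₁ _ _) _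
      have hbound : ‖F x₁ k - F x₂ k‖ ≤ 2 * M := by
        refine (norm_sub_le _ _).trans ?_
        rw [two_mul]
        exact add_le_add (hfb _ _ _) (hfb _ _ _)
      have hlip : ‖F x₁ k - F x₂ k‖ ≤ ε (k - 1) * (d + (C * d ^ α + S)) := by
        refine (hfl _ _ _ _).trans (mul_le_mul_of_nonneg_left ?_ (hε0 _))
        rw [add_sub_add_comm]
        exact (norm_add_le _ _).trans (add_le_add le_rfl (ih _ _ _ _))
      have hε : 0 ≤ ε (k - 1) ^ α := Real.rpow_nonneg (hε0 _) _
      refine (le_rpow_mul_rpow_add_of_le_of_le hM hC hα0 hα1 (hε0 _) (hεN _) hd0 hS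
        hbound hlip).trans ?_
      gcongr
    have hmajor := ((hsum n).hasSum.mul_left (W * (1 + C) * r)).add
      ((hqsum n).hasSum.mul_right S)
    rw [hdiff]
    refine (tsum_of_norm_bounded hmajor fun k => ?_).trans ?_
    · calc ‖GreenD 𝒜 P n k (F x₁ k - F x₂ k)‖
          ≤ ‖GreenD 𝒜 P n k‖ *
            (W * (1 + C) * (ε (k - 1) ^ α * (Δ₁ (k - 1) n ^ α * r)) + ε (k - 1) * S) :=
            (ContinuousLinearMap.le_opNorm _ _).trans
              (mul_le_mul_of_nonneg_left (hFdiff k) (norm_nonneg _))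
        _ = _ := by ring
    · refine add_le_add ?_ (mul_le_mul_of_nonneg_right (hq n) hS)
      rw [mul_right_comm]
      exact mul_le_mul_of_nonneg_right (hcond n) hr0
  have hB0 : 0 ≤ B := (norm_nonneg _).trans (hB 0 0 0)
  have hiter : ∀ (j : ℕ) n x₁ x₂ y,
      ‖h n x₁ y - h n x₂ y‖ ≤ C * ‖x₁ - x₂‖ ^ α + q ^ j * (2 * B) := by
    intro j
    induction j with
    | zero =>
      intro n x₁ x₂ y
      have hr0 : 0 ≤ C * ‖x₁ - x₂‖ ^ α := by positivity
      linarith [norm_sub_le (h n x₁ y) (h n x₂ y), hB n x₁ y, hB n x₂ y]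
    | succ j ih =>
      intro n x₁ x₂ y
      rw [pow_succ', mul_assoc]
      exact hstep _ (by positivity) ih n x₁ x₂ y
  intro n x₁ x₂ y
  have hlim := ((tendsto_pow_atTop_nhds_zero_of_lt_one hq0 hq1).mul_const (2 * B)).const_add
    (C * ‖x₁ - x₂‖ ^ α)
  rw [zero_mul, add_zero] at hlim
  exact ge_of_tendsto' hlim fun j => hiter j n x₁ x₂ y
end

section
/- Let C > 0 and 0 < α < 1 be given. If 2M · sup_{n∈ℤ} Σ_{m=−∞}^{∞} |𝒢(n,m)| ε_{m−1}^α Δ₂(m−1,n)^α ≤ C, then the maps h̄_n from the conjugacies H̄_n(x,y) = (x + h̄_n(x,y), y) satisfy |h̄_n(x₁,y) − h̄_n(x₂,y)| ≤ C |x₁ − x₂|^α for all n ∈ ℤ, x₁, x₂ ∈ X and y ∈ Y. -/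
open MeasureTheory

/-- `(x, y)` is a solution of the coupled system
`x_{n+1} = A_n x_n + f_n(x_n, y_n)`, `y_{n+1} = g_n(y_n)`. -/
def IsSolNLD {X Y : Type*} [NormedAddCommGroup X] [NormedSpace ℝ X] [TopologicalSpace Y]
    (A : ℤ → X ≃L[ℝ] X) (f : ℤ → X → Y → X) (g : ℤ → Y ≃ₜ Y)
    (x : ℤ → X) (y : ℤ → Y) : Prop :=
  ∀ n, x (n + 1) = A n (x n) + f n (x n) (y n) ∧ y (n + 1) = g n (y n)

/-- Interpolation between a constant bound `B ≥ 1` and a bound `b`. -/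
lemma le_mul_rpow_of_le_of_le_s14 {a b B α : ℝ} (ha : 0 ≤ a) (hB : 1 ≤ B) (haB : a ≤ B) (hab : a ≤ b)
    (hα0 : 0 < α) (hα1 : α < 1) : a ≤ B * b ^ α := by
  calc a = a ^ ((1 - α) + α) := by simp
    _ = a ^ (1 - α) * a ^ α := Real.rpow_add_of_nonneg ha (by linarith) hα0.le
    _ ≤ B ^ (1 - α) * b ^ α := by gcongr
    _ ≤ B * b ^ α := by
      gcongr
      · exact Real.rpow_nonneg (ha.trans hab) α
      · exact (Real.rpow_le_rpow_of_exponent_le hB (by linarith)).trans_eq (Real.rpow_one B)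

theorem discrete_holder_in_x_of_hbar
    {X Y : Type*} [NormedAddCommGroup X] [NormedSpace ℝ X] [CompleteSpace X]
    [NormedAddCommGroup Y] [NormedSpace ℝ Y] [CompleteSpace Y]
    (A : ℤ → X ≃L[ℝ] X)
    (𝒜 : ℤ → ℤ → X →L[ℝ] X) (h𝒜 : IsCocycle A 𝒜)
    (f : ℤ → X → Y → X) (hf : ∀ n, Continuous fun p : X × Y => f n p.1 p.2)
    (g : ℤ → Y ≃ₜ Y)
    (Φ : ℤ → ℤ → Y → Y) (hΦ : IsFlowD g Φ)
    (P : ℤ → X →L[ℝ] X)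
    -- `Ψ` is the `x`-component of the flow of the coupled system (2d)
    (Ψ : ℤ → ℤ → X → Y → X)
    (hΨ : ∀ (n : ℤ) (ξ : X) (η : Y),
      IsSolNLD A f g (fun m => Ψ m n ξ η) (fun m => Φ m n η) ∧ Ψ n n ξ η = ξ)
    -- the bound `Δ₂` on differences of solutions of (2d) with the same `y`-component
    (Δ₂ : ℤ → ℤ → ℝ) (hΔ₂pos : ∀ m n, 0 < Δ₂ m n)
    (hΔ₂ : ∀ (x z : ℤ → X) (y : ℤ → Y), IsSolNLD A f g x y → IsSolNLD A f g z y →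
      ∀ m n, ‖x m - z m‖ ≤ Δ₂ m n * ‖x n - z n‖)
    -- bounds on `f`
    (M N : ℝ) (hM : 1 ≤ M) (hN : 1 ≤ N)
    (ε : ℤ → ℝ) (hε0 : ∀ n, 0 ≤ ε n) (hεN : ∀ n, ε n ≤ N)
    (hfb : ∀ n x y, ‖f n x y‖ ≤ M)
    (hfl : ∀ (n : ℤ) (x₁ x₂ : X) (y : Y), ‖f n x₁ y - f n x₂ y‖ ≤ ε n * ‖x₁ - x₂‖)
    -- summability conditions
    (K q : ℝ)
    (hKsum : ∀ m, Summable fun n : ℤ => ‖GreenD 𝒜 P m n‖)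
    (hK : ∀ m, (∑' n : ℤ, ‖GreenD 𝒜 P m n‖) ≤ K)
    (hqsum : ∀ m, Summable fun n : ℤ => ‖GreenD 𝒜 P m n‖ * ε (n - 1))
    (hq : ∀ m, (∑' n : ℤ, ‖GreenD 𝒜 P m n‖ * ε (n - 1)) ≤ q)
    (hq1 : q < 1)
    -- `h̄` is the conjugacy from the discrete linearization theorem
    (hbar : ℤ → X → Y → X)
    (hbarfix : ∀ (n : ℤ) (ξ : X) (η : Y), hbar n ξ η =
      -∑' k : ℤ, GreenD 𝒜 P n k (f (k - 1) (Ψ (k - 1) n ξ η) (Φ (k - 1) n η)))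
    -- the Hölder data
    (C α : ℝ) (hC : 0 < C) (hα0 : 0 < α) (hα1 : α < 1)
    (hsum : ∀ n, Summable fun m : ℤ =>
      ‖GreenD 𝒜 P n m‖ * ε (m - 1) ^ α * Δ₂ (m - 1) n ^ α)
    (hcond : ∀ n, 2 * M *
      (∑' m : ℤ, ‖GreenD 𝒜 P n m‖ * ε (m - 1) ^ α * Δ₂ (m - 1) n ^ α) ≤ C) :
    ∀ (n : ℤ) (x₁ x₂ : X) (y : Y), ‖hbar n x₁ y - hbar n x₂ y‖ ≤ C * ‖x₁ - x₂‖ ^ α := by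
  intro n x₁ x₂ y
  have hsummable : ∀ ξ, Summable fun k : ℤ =>
      GreenD 𝒜 P n k (f (k - 1) (Ψ (k - 1) n ξ y) (Φ (k - 1) n y)) := fun ξ =>
    Summable.of_norm_bounded ((hKsum n).mul_right M) fun k =>
      (GreenD 𝒜 P n k).le_opNorm_of_le (hfb _ _ _)
  have hflow : ∀ m, ‖Ψ m n x₁ y - Ψ m n x₂ y‖ ≤ Δ₂ m n * ‖x₁ - x₂‖ := fun m => by
    simpa only [(hΨ n x₁ y).2, (hΨ n x₂ y).2] using
      hΔ₂ _ _ _ (hΨ n x₁ y).1 (hΨ n x₂ y).1 m n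
  have hnonlin : ∀ m, ‖f m (Ψ m n x₁ y) (Φ m n y) - f m (Ψ m n x₂ y) (Φ m n y)‖ ≤
      2 * M * (ε m * (Δ₂ m n * ‖x₁ - x₂‖)) ^ α := fun m => by
    refine le_mul_rpow_of_le_of_le_s14 (norm_nonneg _) (by linarith) ?_ ?_ hα0 hα1
    · exact (norm_sub_le_of_le (hfb _ _ _) (hfb _ _ _)).trans_eq (two_mul M).symm
    · exact (hfl _ _ _ _).trans (mul_le_mul_of_nonneg_left (hflow m) (hε0 m))
  have hterm : ∀ k : ℤ, ‖GreenD 𝒜 P n k (f (k - 1) (Ψ (k - 1) n x₂ y) (Φ (k - 1) n y)) -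
      GreenD 𝒜 P n k (f (k - 1) (Ψ (k - 1) n x₁ y) (Φ (k - 1) n y))‖ ≤
      2 * M * ‖x₁ - x₂‖ ^ α *
        (‖GreenD 𝒜 P n k‖ * ε (k - 1) ^ α * Δ₂ (k - 1) n ^ α) := fun k => by
    rw [norm_sub_rev, ← map_sub]
    refine ((GreenD 𝒜 P n k).le_opNorm_of_le (hnonlin (k - 1))).trans_eq ?_
    have hΔ := (hΔ₂pos (k - 1) n).le
    rw [Real.mul_rpow (hε0 _) (mul_nonneg hΔ (norm_nonneg _)),
      Real.mul_rpow hΔ (norm_nonneg _)]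
    ring
  rw [hbarfix, hbarfix, neg_sub_neg, ← (hsummable x₂).tsum_sub (hsummable x₁)]
  calc _ ≤ 2 * M * ‖x₁ - x₂‖ ^ α *
        ∑' k : ℤ, ‖GreenD 𝒜 P n k‖ * ε (k - 1) ^ α * Δ₂ (k - 1) n ^ α :=
      tsum_of_norm_bounded ((hsum n).hasSum.mul_left _) hterm
    _ = 2 * M * (∑' k : ℤ, ‖GreenD 𝒜 P n k‖ * ε (k - 1) ^ α * Δ₂ (k - 1) n ^ α) *
        ‖x₁ - x₂‖ ^ α := by ring
    _ ≤ C * ‖x₁ - x₂‖ ^ α := by gcongr; exact hcond n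
end

section
/- Let C > 0 and 0 < α < 1 be given. If max{2M, N}(1+C) · sup_{n∈ℤ} Σ_{m=−∞}^{∞} |𝒢(n,m)| ε_{m−1}^α σ(m−1,n)^α ≤ C, then the maps h_n from the conjugacies H_n(x,y) = (x + h_n(x,y), y) satisfy |h_n(x,y₁) − h_n(x,y₂)| ≤ C |y₁ − y₂|^α for all n ∈ ℤ, x ∈ X and y₁, y₂ ∈ Y. -/
open MeasureTheory

/-- The Hölder interpolation between a boundedness estimate and a Lipschitz estimate. -/
theorem min_bound_le_holder_add {M N e C α s E d : ℝ} (hM : 0 ≤ M) (hN : 1 ≤ N) (he0 : 0 ≤ e)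
    (heN : e ≤ N) (hC : 0 ≤ C) (hα0 : 0 < α) (hα1 : α < 1) (hs : 0 ≤ s) (hE : 0 ≤ E)
    (hdM : d ≤ 2 * M) (hde : d ≤ e * (C * s ^ α + E + s)) :
    d ≤ max (2 * M) N * (1 + C) * (e * s) ^ α + e * E := by
  have hes : 0 ≤ e * s := mul_nonneg he0 hs
  have hX : 0 ≤ (e * s) ^ α := Real.rpow_nonneg hes α
  have heE : 0 ≤ e * E := mul_nonneg he0 hE
  rcases le_total 1 (e * s) with h1 | h1
  · have h2 : 1 ≤ (e * s) ^ α := Real.one_le_rpow h1 hα0.le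
    have h3 : 2 * M ≤ max (2 * M) N := le_max_left _ _
    have h4 : 1 ≤ (1 + C) * (e * s) ^ α := by nlinarith
    nlinarith
  · have h2 : e * s ≤ (e * s) ^ α := by
      simpa using Real.rpow_le_rpow_of_exponent_ge' hes h1 hα0.le hα1.le
    have h3 : e ≤ N * e ^ α := by
      rcases he0.eq_or_lt with rfl | hpos
      · simp [Real.zero_rpow hα0.ne']
      · calc e = e ^ (1 - α) * e ^ α := by rw [← Real.rpow_add hpos]; simp
          _ ≤ N * e ^ α := by
            gcongr
            calc e ^ (1 - α) ≤ N ^ (1 - α) := by gcongr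
              _ ≤ N ^ (1 : ℝ) := Real.rpow_le_rpow_of_exponent_le hN (by linarith)
              _ = N := Real.rpow_one N
    have h4 : e * (C * s ^ α) ≤ N * C * (e * s) ^ α := by
      rw [Real.mul_rpow he0 hs]
      have := mul_le_mul_of_nonneg_right h3 (mul_nonneg hC (Real.rpow_nonneg hs α))
      linarith
    have h5 : (e * s) ^ α ≤ N * (e * s) ^ α := le_mul_of_one_le_left hX hN
    have h6 : N * ((1 + C) * (e * s) ^ α) ≤ max (2 * M) N * ((1 + C) * (e * s) ^ α) := by
      gcongr
      exact le_max_right _ _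
    linarith

/-- The difference of two series with bounded arguments is controlled termwise. -/
theorem norm_tsum_apply_sub_le {X : Type*} [NormedAddCommGroup X] [NormedSpace ℝ X]
    [CompleteSpace X] {ι : Type*} {G : ι → X →L[ℝ] X} (hG : Summable fun k => ‖G k‖)
    {u v : ι → X} {M : ℝ} (hu : ∀ k, ‖u k‖ ≤ M) (hv : ∀ k, ‖v k‖ ≤ M)
    {b : ι → ℝ} {S : ℝ} (hb : HasSum (fun k => ‖G k‖ * b k) S) (huv : ∀ k, ‖u k - v k‖ ≤ b k) :
    ‖∑' k, G k (u k) - ∑' k, G k (v k)‖ ≤ S := by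
  have summable_apply {w : ι → X} (hw : ∀ k, ‖w k‖ ≤ M) : Summable fun k => G k (w k) :=
    (hG.mul_right M).of_norm_bounded fun k => (G k).le_opNorm_of_le (hw k)
  rw [← (summable_apply hu).tsum_sub (summable_apply hv)]
  refine tsum_of_norm_bounded hb fun k => ?_
  rw [← map_sub]
  exact (G k).le_opNorm_of_le (huv k)

theorem discrete_holder_in_y_of_h
    {X Y : Type*} [NormedAddCommGroup X] [NormedSpace ℝ X] [CompleteSpace X]
    [NormedAddCommGroup Y] [NormedSpace ℝ Y] [CompleteSpace Y]
    (A : ℤ → X ≃L[ℝ] X)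
    (𝒜 : ℤ → ℤ → X →L[ℝ] X) (h𝒜 : IsCocycle A 𝒜)
    (f : ℤ → X → Y → X) (hf : ∀ n, Continuous fun p : X × Y => f n p.1 p.2)
    (g : ℤ → Y ≃ₜ Y)
    (Φ : ℤ → ℤ → Y → Y) (hΦ : IsFlowD g Φ)
    (P : ℤ → X →L[ℝ] X)
    -- the bound `σ` on differences of solutions of `y_{n+1} = g_n(y_n)`
    (σ : ℤ → ℤ → ℝ) (hσpos : ∀ m n, 0 < σ m n)
    (hσ : ∀ (y w : ℤ → Y), (∀ n, y (n + 1) = g n (y n)) → (∀ n, w (n + 1) = g n (w n)) →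
      ∀ m n, ‖y m - w m‖ ≤ σ m n * ‖y n - w n‖)
    -- bounds on `f`
    (M N : ℝ) (hM : 1 ≤ M) (hN : 1 ≤ N)
    (ε : ℤ → ℝ) (hε0 : ∀ n, 0 ≤ ε n) (hεN : ∀ n, ε n ≤ N)
    (hfb : ∀ n x y, ‖f n x y‖ ≤ M)
    (hfl : ∀ (n : ℤ) (x₁ x₂ : X) (y₁ y₂ : Y),
      ‖f n x₁ y₁ - f n x₂ y₂‖ ≤ ε n * (‖x₁ - x₂‖ + ‖y₁ - y₂‖))
    -- summability conditions
    (K q : ℝ)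
    (hKsum : ∀ m, Summable fun n : ℤ => ‖GreenD 𝒜 P m n‖)
    (hK : ∀ m, (∑' n : ℤ, ‖GreenD 𝒜 P m n‖) ≤ K)
    (hqsum : ∀ m, Summable fun n : ℤ => ‖GreenD 𝒜 P m n‖ * ε (n - 1))
    (hq : ∀ m, (∑' n : ℤ, ‖GreenD 𝒜 P m n‖ * ε (n - 1)) ≤ q)
    (hq1 : q < 1)
    -- `h` is the conjugacy: the bounded continuous fixed point of the operator `T`
    (h : ℤ → X → Y → X)
    (hhc : ∀ n, Continuous fun p : X × Y => h n p.1 p.2)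
    (hhb : ∃ B : ℝ, ∀ n x y, ‖h n x y‖ ≤ B)
    (hfix : ∀ (n : ℤ) (ξ : X) (η : Y), h n ξ η =
      ∑' k : ℤ, GreenD 𝒜 P n k
        (f (k - 1) (𝒜 (k - 1) n ξ + h (k - 1) (𝒜 (k - 1) n ξ) (Φ (k - 1) n η))
          (Φ (k - 1) n η)))
    -- the Hölder data
    (C α : ℝ) (hC : 0 < C) (hα0 : 0 < α) (hα1 : α < 1)
    (hsum : ∀ n, Summable fun m : ℤ =>
      ‖GreenD 𝒜 P n m‖ * ε (m - 1) ^ α * σ (m - 1) n ^ α)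
    (hcond : ∀ n, max (2 * M) N * (1 + C) *
      (∑' m : ℤ, ‖GreenD 𝒜 P n m‖ * ε (m - 1) ^ α * σ (m - 1) n ^ α) ≤ C) :
    ∀ (n : ℤ) (x : X) (y₁ y₂ : Y), ‖h n x y₁ - h n x y₂‖ ≤ C * ‖y₁ - y₂‖ ^ α := by
  obtain ⟨B, hB⟩ := hhb
  have hq0 : 0 ≤ q :=
    (tsum_nonneg fun k => mul_nonneg (norm_nonneg _) (hε0 _)).trans (hq 0)
  have improve (E : ℝ) (hE0 : 0 ≤ E)
      (hE : ∀ n x y₁ y₂, ‖h n x y₁ - h n x y₂‖ ≤ C * ‖y₁ - y₂‖ ^ α + E) :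
      ∀ n x y₁ y₂, ‖h n x y₁ - h n x y₂‖ ≤ C * ‖y₁ - y₂‖ ^ α + q * E := by
    intro n x y₁ y₂
    have hS := ((hsum n).hasSum.mul_left
      (max (2 * M) N * (1 + C) * ‖y₁ - y₂‖ ^ α)).add ((hqsum n).hasSum.mul_right E)
    rw [hfix n x y₁, hfix n x y₂]
    refine (norm_tsum_apply_sub_le (hKsum n) (M := M) (fun _ => hfb _ _ _)
      (fun _ => hfb _ _ _) (b := fun k => max (2 * M) N * (1 + C) *
        (ε (k - 1) * (σ (k - 1) n * ‖y₁ - y₂‖)) ^ α + ε (k - 1) * E)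
      (hS.congr_fun fun k => ?_) fun k => ?_).trans ?_
    · have hσ0 := (hσpos (k - 1) n).le
      rw [Real.mul_rpow (hε0 _) (by positivity), Real.mul_rpow hσ0 (norm_nonneg _)]
      ring
    · have hs := hσ (fun m => Φ m n y₁) (fun m => Φ m n y₂) (fun m => hΦ.2 m n y₁)
        (fun m => hΦ.2 m n y₂) (k - 1) n
      simp only [hΦ.1] at hs
      have hσ0 := (hσpos (k - 1) n).le
      refine min_bound_le_holder_add (by linarith) hN (hε0 _) (hεN _) hC.le hα0 hα1
        (by positivity) hE0 ?_ ?_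
      · refine (norm_sub_le _ _).trans ?_
        rw [two_mul]
        exact add_le_add (hfb _ _ _) (hfb _ _ _)
      · refine (hfl _ _ _ _ _).trans (mul_le_mul_of_nonneg_left ?_ (hε0 _))
        rw [add_sub_add_left_eq_sub]
        refine add_le_add ((hE _ _ _ _).trans ?_) hs
        gcongr
    · have h1 := mul_le_mul_of_nonneg_right (hcond n)
        (Real.rpow_nonneg (norm_nonneg (y₁ - y₂)) α)
      have h2 := mul_le_mul_of_nonneg_right (hq n) hE0
      linarith
  intro n x y₁ y₂
  have hB0 : 0 ≤ B := (norm_nonneg _).trans (hB n x y₁)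
  have iterate (j : ℕ) : ∀ n x y₁ y₂,
      ‖h n x y₁ - h n x y₂‖ ≤ C * ‖y₁ - y₂‖ ^ α + q ^ j * (2 * B) := by
    induction j with
    | zero =>
      intro n x y₁ y₂
      have h1 := norm_sub_le (h n x y₁) (h n x y₂)
      have h2 : 0 ≤ C * ‖y₁ - y₂‖ ^ α := by positivity
      linarith [hB n x y₁, hB n x y₂]
    | succ j ih =>
      simpa only [pow_succ', mul_assoc] using improve _ (by positivity) ih
  refine ge_of_tendsto' (x := Filter.atTop) ?_ fun j => iterate j n x y₁ y₂
  simpa using ((tendsto_pow_atTop_nhds_zero_of_lt_one hq0 hq1).mul_const (2 * B)).const_add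
    (C * ‖y₁ - y₂‖ ^ α)
end

section
/- Let C > 0 and 0 < α < 1 be given. If 2M · sup_{n∈ℤ} Σ_{m=−∞}^{∞} |𝒢(n,m)| ε_{m−1}^α Δ₃(m−1,n)^α ≤ C, then the maps h̄_n from the conjugacies H̄_n(x,y) = (x + h̄_n(x,y), y) satisfy |h̄_n(x,y₁) − h̄_n(x,y₂)| ≤ C |y₁ − y₂|^α for all n ∈ ℤ, x ∈ X and y₁, y₂ ∈ Y. -/
open MeasureTheory

/-- Interpolation between a constant bound `B ≥ 1` and a bound `s`. -/
theorem le_mul_rpow_of_le_of_le_s16 {t s B α : ℝ} (ht : 0 ≤ t) (hB : 1 ≤ B) (htB : t ≤ B)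
    (hts : t ≤ s) (hα0 : 0 ≤ α) (hα1 : α ≤ 1) : t ≤ B * s ^ α := by
  have hsplit : t = t ^ (1 - α) * t ^ α := by
    rw [← Real.rpow_add' ht (by simp)]
    simp
  calc t = t ^ (1 - α) * t ^ α := hsplit
    _ ≤ B ^ (1 - α) * s ^ α := by
        have h1 : 0 ≤ 1 - α := sub_nonneg.2 hα1
        gcongr
    _ ≤ B * s ^ α := by
        refine mul_le_mul_of_nonneg_right ?_ (Real.rpow_nonneg (ht.trans hts) α)
        exact Real.rpow_le_self_of_one_le hB (by linarith)

/-- Operators with summable norms applied to bounded vectors give a summable family. -/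
theorem summable_clm_apply_of_bounded {ι X : Type*} [NormedAddCommGroup X] [NormedSpace ℝ X]
    [CompleteSpace X] {G : ι → X →L[ℝ] X} {v : ι → X} {M : ℝ}
    (hG : Summable fun i => ‖G i‖) (hv : ∀ i, ‖v i‖ ≤ M) : Summable fun i => G i (v i) :=
  Summable.of_norm_bounded (hG.mul_right M) fun i =>
    ((G i).le_opNorm (v i)).trans (mul_le_mul_of_nonneg_left (hv i) (norm_nonneg _))

theorem discrete_holder_in_y_of_hbar
    {X Y : Type*} [NormedAddCommGroup X] [NormedSpace ℝ X] [CompleteSpace X]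
    [NormedAddCommGroup Y] [NormedSpace ℝ Y] [CompleteSpace Y]
    (A : ℤ → X ≃L[ℝ] X)
    (𝒜 : ℤ → ℤ → X →L[ℝ] X) (h𝒜 : IsCocycle A 𝒜)
    (f : ℤ → X → Y → X) (hf : ∀ n, Continuous fun p : X × Y => f n p.1 p.2)
    (g : ℤ → Y ≃ₜ Y)
    (Φ : ℤ → ℤ → Y → Y) (hΦ : IsFlowD g Φ)
    (P : ℤ → X →L[ℝ] X)
    -- `Ψ` is the `x`-component of the flow of the coupled system (2d)
    (Ψ : ℤ → ℤ → X → Y → X)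
    (hΨ : ∀ (n : ℤ) (ξ : X) (η : Y),
      IsSolNLD A f g (fun m => Ψ m n ξ η) (fun m => Φ m n η) ∧ Ψ n n ξ η = ξ)
    -- the bound `Δ₃` on differences of solutions of (2d) agreeing in `x` at time `n`
    (Δ₃ : ℤ → ℤ → ℝ) (hΔ₃pos : ∀ m n, 0 < Δ₃ m n)
    (hΔ₃ : ∀ (x z : ℤ → X) (y w : ℤ → Y), IsSolNLD A f g x y → IsSolNLD A f g z w →
      ∀ m n, x n = z n → ‖x m - z m‖ + ‖y m - w m‖ ≤ Δ₃ m n * ‖y n - w n‖)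
    -- bounds on `f`
    (M N : ℝ) (hM : 1 ≤ M) (hN : 1 ≤ N)
    (ε : ℤ → ℝ) (hε0 : ∀ n, 0 ≤ ε n) (hεN : ∀ n, ε n ≤ N)
    (hfb : ∀ n x y, ‖f n x y‖ ≤ M)
    (hfl : ∀ (n : ℤ) (x₁ x₂ : X) (y₁ y₂ : Y),
      ‖f n x₁ y₁ - f n x₂ y₂‖ ≤ ε n * (‖x₁ - x₂‖ + ‖y₁ - y₂‖))
    -- summability conditions
    (K q : ℝ)
    (hKsum : ∀ m, Summable fun n : ℤ => ‖GreenD 𝒜 P m n‖)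
    (hK : ∀ m, (∑' n : ℤ, ‖GreenD 𝒜 P m n‖) ≤ K)
    (hqsum : ∀ m, Summable fun n : ℤ => ‖GreenD 𝒜 P m n‖ * ε (n - 1))
    (hq : ∀ m, (∑' n : ℤ, ‖GreenD 𝒜 P m n‖ * ε (n - 1)) ≤ q)
    (hq1 : q < 1)
    -- `h̄` is the conjugacy from the discrete linearization theorem
    (hbar : ℤ → X → Y → X)
    (hbarfix : ∀ (n : ℤ) (ξ : X) (η : Y), hbar n ξ η =
      -∑' k : ℤ, GreenD 𝒜 P n k (f (k - 1) (Ψ (k - 1) n ξ η) (Φ (k - 1) n η)))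
    -- the Hölder data
    (C α : ℝ) (hC : 0 < C) (hα0 : 0 < α) (hα1 : α < 1)
    (hsum : ∀ n, Summable fun m : ℤ =>
      ‖GreenD 𝒜 P n m‖ * ε (m - 1) ^ α * Δ₃ (m - 1) n ^ α)
    (hcond : ∀ n, 2 * M *
      (∑' m : ℤ, ‖GreenD 𝒜 P n m‖ * ε (m - 1) ^ α * Δ₃ (m - 1) n ^ α) ≤ C) :
    ∀ (n : ℤ) (x : X) (y₁ y₂ : Y), ‖hbar n x y₁ - hbar n x y₂‖ ≤ C * ‖y₁ - y₂‖ ^ α := by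
  intro n x y₁ y₂
  let u : Y → ℤ → X := fun y k => f (k - 1) (Ψ (k - 1) n x y) (Φ (k - 1) n y)
  have hdiff (k : ℤ) : ‖u y₂ k - u y₁ k‖ ≤
      2 * M * (ε (k - 1) ^ α * Δ₃ (k - 1) n ^ α * ‖y₁ - y₂‖ ^ α) := by
    have hsol := hΔ₃ _ _ _ _ (hΨ n x y₂).1 (hΨ n x y₁).1 (k - 1) n
      ((hΨ n x y₂).2.trans (hΨ n x y₁).2.symm)
    simp only [hΦ.1, norm_sub_rev y₂ y₁] at hsol
    have hbound : ‖u y₂ k - u y₁ k‖ ≤ 2 * M :=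
      (norm_sub_le _ _).trans (by
        linarith [hfb (k - 1) (Ψ (k - 1) n x y₁) (Φ (k - 1) n y₁),
          hfb (k - 1) (Ψ (k - 1) n x y₂) (Φ (k - 1) n y₂)])
    have hlip : ‖u y₂ k - u y₁ k‖ ≤ ε (k - 1) * (Δ₃ (k - 1) n * ‖y₁ - y₂‖) :=
      (hfl _ _ _ _ _).trans (mul_le_mul_of_nonneg_left hsol (hε0 _))
    have hΔ := (hΔ₃pos (k - 1) n).le
    rw [mul_assoc (ε (k - 1) ^ α), ← Real.mul_rpow hΔ (norm_nonneg _),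
      ← Real.mul_rpow (hε0 _) (mul_nonneg hΔ (norm_nonneg _))]
    exact le_mul_rpow_of_le_of_le_s16 (norm_nonneg _) (by linarith) hbound hlip hα0.le hα1.le
  have hsummable (y : Y) : Summable fun k => GreenD 𝒜 P n k (u y k) :=
    summable_clm_apply_of_bounded (hKsum n) fun k => hfb _ _ _
  have hsub : hbar n x y₁ - hbar n x y₂ = ∑' k, GreenD 𝒜 P n k (u y₂ k - u y₁ k) := by
    simp only [map_sub]
    rw [(hsummable y₂).tsum_sub (hsummable y₁), hbarfix, hbarfix, neg_sub_neg]
  have hmajor := ((hsum n).hasSum.mul_left (2 * M)).mul_right (‖y₁ - y₂‖ ^ α)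
  rw [hsub]
  refine (tsum_of_norm_bounded hmajor fun k => ?_).trans
    (mul_le_mul_of_nonneg_right (hcond n) (Real.rpow_nonneg (norm_nonneg _) α))
  calc ‖GreenD 𝒜 P n k (u y₂ k - u y₁ k)‖
      ≤ ‖GreenD 𝒜 P n k‖ * ‖u y₂ k - u y₁ k‖ := ContinuousLinearMap.le_opNorm _ _
    _ ≤ ‖GreenD 𝒜 P n k‖ * (2 * M * (ε (k - 1) ^ α * Δ₃ (k - 1) n ^ α * ‖y₁ - y₂‖ ^ α)) :=
        mul_le_mul_of_nonneg_left (hdiff k) (norm_nonneg _)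
    _ = _ := by ring
end
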